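/- arXiv:0810.4060 — 3 statements merged into one kernel-verified Lean document; each statement's English description precedes it below -/
import Mathlib

section
/- Let P = ⟨X | R⟩ be a finite presentation of a group G and let H ≤ G have finite generating set Y. Suppose there is a function K : ℕ → ℕ such that for every null-homotopic word w over X ∪ X^{-1} there exists a P-expression E_w for w with Dep_X(E_w, H) ≤ K(Dep_X(w, H)). Then: (1) there exists a finite set S of elements of F(Y) such that ⟨Y | S⟩ presents H; and (2) if in addition there is a function α : ℕ → ℕ with Area(E_w) ≤ α(|w|) for every such w, then α is an isoperimetric function for H. -/
open Subgroup

/-- Reduced word length in a free group. -/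
noncomputable def fgNorm {X : Type*} (w : FreeGroup X) : ℕ :=
  @FreeGroup.norm X (Classical.decEq X) w

/-- `w` is a product of exactly `N` conjugates of elements of `R ∪ R⁻¹`. -/
def ExprOf {X : Type*} (R : Set (FreeGroup X)) (w : FreeGroup X) (N : ℕ) : Prop :=
  ∃ l : List (FreeGroup X × FreeGroup X),
    l.length = N ∧ (∀ p ∈ l, p.2 ∈ R ∨ p.2⁻¹ ∈ R) ∧
    (l.map fun p => p.1 * p.2 * p.1⁻¹).prod = w

/-- The area of a null-homotopic word: the least number of conjugates of relators needed. -/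
noncomputable def area {X : Type*} (R : Set (FreeGroup X)) (w : FreeGroup X) : ℕ :=
  sInf {N | ExprOf R w N}

/-- The Dehn function of the presentation with relator set `R`. -/
noncomputable def dehn {X : Type*} (R : Set (FreeGroup X)) (l : ℕ) : ℕ :=
  sSup {A | ∃ w ∈ Subgroup.normalClosure R, fgNorm w ≤ l ∧ A = area R w}

/-- `f ⪯ g`. -/
def Preceq (f g : ℕ → ℕ) : Prop := ∃ C : ℕ, ∀ l, f l ≤ C * g (C * l + C) + C * l + C

/-- `f ≃ g`. -/
def FEquiv (f g : ℕ → ℕ) : Prop := Preceq f g ∧ Preceq g f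

/-- `φ` realizes `⟨X | R⟩` as a presentation of `G`. -/
def Presents {X : Type*} {G : Type*} [Group G] (R : Set (FreeGroup X))
    (φ : FreeGroup X →* G) : Prop :=
  Function.Surjective φ ∧ φ.ker = Subgroup.normalClosure R

def FinitelyPresentedGroup (G : Type*) [Group G] : Prop :=
  ∃ (X : Type) (_ : Finite X) (R : Set (FreeGroup X)) (φ : FreeGroup X →* G),
    R.Finite ∧ Presents R φ

/-- `f` is an isoperimetric function for `G` : the Dehn function of every finite
presentation of `G` is `⪯ f`. -/
def IsIsopFunction (G : Type*) [Group G] (f : ℕ → ℕ) : Prop :=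
  ∀ (X : Type) (R : Set (FreeGroup X)) (φ : FreeGroup X →* G),
    Finite X → R.Finite → Presents R φ → Preceq (dehn R) f

/-- `(α, ρ)` is an area-radius pair for the presentation with relator set `R`. -/
def IsAreaRadiusPair {X : Type*} (R : Set (FreeGroup X)) (α ρ : ℕ → ℕ) : Prop :=
  ∀ w ∈ Subgroup.normalClosure R, ∀ l : ℕ, fgNorm w ≤ l →
    ∃ L : List (FreeGroup X × FreeGroup X), L.length ≤ α l ∧
      (∀ p ∈ L, (p.2 ∈ R ∨ p.2⁻¹ ∈ R) ∧ fgNorm p.1 ≤ ρ l) ∧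
      (L.map fun p => p.1 * p.2 * p.1⁻¹).prod = w

/-- `g` is a product of at most `k` elements of `S ∪ S⁻¹`. -/
def WordLe {G : Type*} [Group G] (S : Set G) (g : G) (k : ℕ) : Prop :=
  ∃ l : List G, l.length ≤ k ∧ (∀ x ∈ l, x ∈ S ∨ x⁻¹ ∈ S) ∧ l.prod = g

/-- Word length of `g` with respect to the generating set `S`. -/
noncomputable def wordLength {G : Type*} [Group G] (S : Set G) (g : G) : ℕ :=
  sInf {k | WordLe S g k}

/-- Distance from `g` to the subgroup `H` in the word metric determined by `S`. -/
noncomputable def distToSubgroup {G : Type*} [Group G] (S : Set G) (H : Subgroup G)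
    (g : G) : ℕ :=
  sInf {k | ∃ h ∈ H, WordLe S (g⁻¹ * h) k}

/-- The departure from `H` of the word `L` over the alphabet `X × Bool`: the maximal distance
to `H` of the image in `G` of a prefix of `L`. -/
noncomputable def depWord {X G : Type*} [Group G] (φ : FreeGroup X →* G) (H : Subgroup G)
    (L : List (X × Bool)) : ℕ :=
  (Finset.range (L.length + 1)).sup fun j =>
    distToSubgroup (Set.range fun x => φ (FreeGroup.of x)) H (φ (FreeGroup.mk (L.take j)))

namespace ExprOf

variable {X : Type*} {R : Set (FreeGroup X)} {v w : FreeGroup X} {M N : ℕ}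

theorem one : ExprOf R (1 : FreeGroup X) 0 := ⟨[], by simp⟩

theorem of_mem (h : w ∈ R ∨ w⁻¹ ∈ R) : ExprOf R w 1 := ⟨[(1, w)], by simpa using h⟩

theorem mul (hv : ExprOf R v M) (hw : ExprOf R w N) : ExprOf R (v * w) (M + N) := by
  obtain ⟨l, hl, hR, rfl⟩ := hv
  obtain ⟨l', hl', hR', rfl⟩ := hw
  refine ⟨l ++ l', by simp [hl, hl'], fun p hp => ?_, by simp⟩
  rcases List.mem_append.1 hp with h | h
  exacts [hR p h, hR' p h]

theorem conj (x : FreeGroup X) (hw : ExprOf R w N) : ExprOf R (x * w * x⁻¹) N := by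
  obtain ⟨l, rfl, hR, rfl⟩ := hw
  induction l with
  | nil => simpa using one
  | cons p l ih =>
    have hp : ExprOf R (x * (p.1 * p.2 * p.1⁻¹) * x⁻¹) 1 :=
      ⟨[(x * p.1, p.2)], rfl, by simpa using hR p (by simp), by simp [mul_assoc]⟩
    have := hp.mul (ih fun q hq => hR q (by simp [hq]))
    rw [List.length_cons, add_comm]
    convert this using 1
    simp [mul_assoc]

theorem inv (hw : ExprOf R w N) : ExprOf R w⁻¹ N := by
  obtain ⟨l, rfl, hR, rfl⟩ := hw
  induction l with
  | nil => simpa using one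
  | cons p l ih =>
    have hp : ExprOf R (p.1 * p.2⁻¹ * p.1⁻¹) 1 :=
      ⟨[(p.1, p.2⁻¹)], rfl, by simpa [or_comm] using hR p (by simp), by simp⟩
    have := (ih fun q hq => hR q (by simp [hq])).mul hp
    rw [List.length_cons]
    convert this using 1
    simp [mul_assoc]

theorem mem_normalClosure (hw : ExprOf R w N) : w ∈ normalClosure R := by
  obtain ⟨l, -, hR, rfl⟩ := hw
  refine Subgroup.list_prod_mem _ fun x hx => ?_
  obtain ⟨p, hp, rfl⟩ := List.mem_map.1 hx
  refine normalClosure_normal.conj_mem _ ?_ _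
  rcases hR p hp with h | h
  · exact subset_normalClosure h
  · exact inv_mem_iff.1 (subset_normalClosure h)

theorem exists_of_mem_normalClosure (hw : w ∈ normalClosure R) : ∃ N, ExprOf R w N := by
  induction hw using Subgroup.closure_induction with
  | mem x hx =>
    obtain ⟨r, hr, hc⟩ := Group.mem_conjugatesOfSet_iff.1 hx
    obtain ⟨c, rfl⟩ := isConj_iff.1 hc
    exact ⟨1, (of_mem (Or.inl hr)).conj c⟩
  | one => exact ⟨0, one⟩
  | mul x y _ _ hx hy =>
    obtain ⟨M, hM⟩ := hx
    obtain ⟨N, hN⟩ := hy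
    exact ⟨_, hM.mul hN⟩
  | inv x _ hx =>
    obtain ⟨M, hM⟩ := hx
    exact ⟨_, hM.inv⟩

/-- Expressions over a finite set of consequences of `R` become expressions over `R` at the cost
of a multiplicative constant. -/
theorem exists_area_le_mul {S : Set (FreeGroup X)} (hS : S.Finite)
    (hSR : S ⊆ normalClosure R) :
    ∃ A : ℕ, ∀ (w : FreeGroup X) (N : ℕ), ExprOf S w N → area R w ≤ A * N := by
  have hex : ∀ s : FreeGroup X, ∃ n, s ∈ S → ExprOf R s n := fun s => by
    by_cases hs : s ∈ S
    · obtain ⟨n, hn⟩ := exists_of_mem_normalClosure (hSR hs)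
      exact ⟨n, fun _ => hn⟩
    · exact ⟨0, fun h => absurd h hs⟩
  choose a ha using hex
  obtain ⟨A, hA⟩ := (hS.image a).bddAbove
  refine ⟨A, fun w N hw => ?_⟩
  suffices h : ∃ M ≤ A * N, ExprOf R w M by
    obtain ⟨M, hM, hR⟩ := h
    exact (Nat.sInf_le hR).trans hM
  obtain ⟨l, rfl, hl, rfl⟩ := hw
  induction l with
  | nil => exact ⟨0, by simp, by simpa using one⟩
  | cons p l ih =>
    obtain ⟨M, hM, hR⟩ := ih fun q hq => hl q (by simp [hq])
    have hp : ∃ n ≤ A, ExprOf R p.2 n := by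
      rcases hl p (by simp) with h | h
      · exact ⟨_, hA ⟨_, h, rfl⟩, ha _ h⟩
      · exact ⟨_, hA ⟨_, h, rfl⟩, by simpa using (ha _ h).inv⟩
    obtain ⟨n, hn, hpn⟩ := hp
    refine ⟨n + M, ?_, by simpa using (hpn.conj p.1).mul hR⟩
    rw [List.length_cons]
    nlinarith

end ExprOf

section Departure

variable {X G : Type*} [Group G]

theorem wordLe_mk_inv (φ : FreeGroup X →* G) (L : List (X × Bool)) :
    WordLe (Set.range fun x => φ (FreeGroup.of x)) (φ (FreeGroup.mk L))⁻¹ L.length := by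
  induction L with
  | nil => exact ⟨[], by simp, by simp, by simp [← FreeGroup.one_eq_mk]⟩
  | cons a L ih =>
    obtain ⟨l, hl, hS, hprod⟩ := ih
    have hmk : (FreeGroup.mk (a :: L)) = FreeGroup.mk [a] * FreeGroup.mk L := by
      simp [FreeGroup.mul_mk]
    refine ⟨l ++ [(φ (FreeGroup.mk [a]))⁻¹], by simpa using hl, ?_,
      by rw [List.prod_append, hprod, List.prod_singleton, hmk, map_mul, mul_inv_rev]⟩
    intro x hx
    rcases List.mem_append.1 hx with h | h
    · exact hS x h
    · rw [List.mem_singleton] at h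
      subst h
      obtain ⟨y, b⟩ := a
      cases b
      · refine Or.inl ⟨y, ?_⟩
        rw [← map_inv]
        rfl
      · exact Or.inr ⟨y, (inv_inv _).symm⟩

theorem WordLe.finite {S : Set G} (hS : S.Finite) (k : ℕ) : {g : G | WordLe S g k}.Finite := by
  have : Finite ↥(S ∪ S⁻¹) := hS.union hS.inv
  refine ((List.finite_length_le (↥(S ∪ S⁻¹)) k).image
    fun l => (l.map Subtype.val).prod).subset ?_
  rintro g ⟨l, hl, hlS, rfl⟩
  refine ⟨l.attach.map fun x => ⟨x.1, hlS x.1 x.2⟩, by simpa using hl, ?_⟩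
  simp [List.map_map, Function.comp_def]

theorem distToSubgroup_mul_left (S : Set G) (H : Subgroup G) {h : G} (hh : h ∈ H) (g : G) :
    distToSubgroup S H (h * g) = distToSubgroup S H g := by
  unfold distToSubgroup
  congr 1
  ext k
  constructor
  · rintro ⟨a, ha, hk⟩
    exact ⟨h⁻¹ * a, H.mul_mem (H.inv_mem hh) ha, by simpa [mul_assoc] using hk⟩
  · rintro ⟨a, ha, hk⟩
    exact ⟨h * a, H.mul_mem hh ha, by simpa [mul_assoc] using hk⟩

theorem distToSubgroup_mk_le (φ : FreeGroup X →* G) (H : Subgroup G) (L : List (X × Bool)) :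
    distToSubgroup (Set.range fun x => φ (FreeGroup.of x)) H (φ (FreeGroup.mk L)) ≤ L.length :=
  Nat.sInf_le ⟨1, H.one_mem, by simpa using wordLe_mk_inv φ L⟩

/-- A word of departure at most `k` ends in the coset of an inverse of an element of the ball of
radius `k`. -/
theorem exists_wordLe_of_depWord_le (φ : FreeGroup X →* G) (H : Subgroup G)
    {L : List (X × Bool)} {k : ℕ} (hL : depWord φ H L ≤ k) :
    ∃ h ∈ H, WordLe (Set.range fun x => φ (FreeGroup.of x)) ((φ (FreeGroup.mk L))⁻¹ * h) k := by
  have hne : {k | ∃ h ∈ H, WordLe (Set.range fun x => φ (FreeGroup.of x))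
      ((φ (FreeGroup.mk L))⁻¹ * h) k}.Nonempty :=
    ⟨L.length, 1, H.one_mem, by simpa using wordLe_mk_inv φ L⟩
  obtain ⟨h, hh, l, hl, hS⟩ := Nat.sInf_mem hne
  refine ⟨h, hh, l, hl.trans (le_trans ?_ hL), hS⟩
  have := Finset.le_sup (f := fun j =>
    distToSubgroup (Set.range fun x => φ (FreeGroup.of x)) H (φ (FreeGroup.mk (L.take j))))
    (Finset.mem_range.2 (Nat.lt_succ_self L.length))
  rwa [List.take_length] at this

theorem depWord_append_le (φ : FreeGroup X →* G) (H : Subgroup G) {U : List (X × Bool)}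
    (hU : φ (FreeGroup.mk U) ∈ H) (L : List (X × Bool)) :
    depWord φ H (U ++ L) ≤ max U.length (depWord φ H L) := by
  refine Finset.sup_le fun j hj => ?_
  rw [Finset.mem_range, List.length_append] at hj
  rcases le_total j U.length with h | h
  · rw [List.take_append_of_le_length h]
    refine le_max_of_le_left ((distToSubgroup_mk_le φ H _).trans ?_)
    simp
  · rw [List.take_append, List.take_of_length_le h, ← FreeGroup.mul_mk, map_mul,
      distToSubgroup_mul_left _ _ hU]
    exact le_max_of_le_right (Finset.le_sup (f := fun j =>
      distToSubgroup (Set.range fun x => φ (FreeGroup.of x)) H (φ (FreeGroup.mk (L.take j))))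
      (Finset.mem_range.2 (by omega)))

theorem depWord_nil (φ : FreeGroup X →* G) (H : Subgroup G) : depWord φ H [] = 0 := by
  refine Nat.le_zero.1 (Finset.sup_le fun j _ => ?_)
  rw [List.take_nil]
  exact distToSubgroup_mk_le φ H []

/-- Any word can be lengthened by `2 * k` letters without changing its class in the free group,
at bounded cost in departure. -/
theorem exists_padding [Nonempty X] (φ : FreeGroup X →* G) (H : Subgroup G)
    (L : List (X × Bool)) (k : ℕ) :
    ∃ L' : List (X × Bool), FreeGroup.mk L' = FreeGroup.mk L ∧
      L'.length = L.length + 2 * k ∧ depWord φ H L' ≤ max 2 (depWord φ H L) := by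
  obtain ⟨x⟩ := ‹Nonempty X›
  have hx : FreeGroup.mk [(x, true), (x, false)] = 1 := by
    rw [FreeGroup.one_eq_mk]
    exact Quot.sound (FreeGroup.Red.Step.not (L₁ := []) (L₂ := []))
  induction k with
  | zero => exact ⟨L, rfl, rfl, le_max_right _ _⟩
  | succ k ih =>
    obtain ⟨L', hmk, hlen, hdep⟩ := ih
    refine ⟨[(x, true), (x, false)] ++ L', ?_, ?_, ?_⟩
    · rw [← FreeGroup.mul_mk, hx, one_mul, hmk]
    · simp only [List.length_append, List.length_cons, List.length_nil, hlen]
      omega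
    · refine (depWord_append_le φ H (by rw [hx, map_one]; exact H.one_mem) L').trans ?_
      exact max_le (le_max_left _ _) hdep

end Departure

section Substitution

variable {X Z G : Type*} [Group G]

/-- Substitute the word `u z` for each letter `z`. -/
def substWord (u : Z → List (X × Bool)) (w : List (Z × Bool)) : List (X × Bool) :=
  w.flatMap fun a => cond a.2 (u a.1) (FreeGroup.invRev (u a.1))

theorem mk_substWord (u : Z → List (X × Bool)) (w : List (Z × Bool)) :
    FreeGroup.mk (substWord u w) =
      FreeGroup.lift (fun z => FreeGroup.mk (u z)) (FreeGroup.mk w) := by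
  induction w with
  | nil => simp [substWord, FreeGroup.one_eq_mk]
  | cons a w ih =>
    obtain ⟨z, b⟩ := a
    rw [FreeGroup.lift_mk] at ih ⊢
    rw [List.map_cons, List.prod_cons, ← ih]
    cases b <;> simp [substWord, FreeGroup.inv_mk, FreeGroup.mul_mk]

theorem length_substWord_le {u : Z → List (X × Bool)} {c : ℕ} (hc : ∀ z, (u z).length ≤ c)
    (w : List (Z × Bool)) : (substWord u w).length ≤ c * w.length := by
  induction w with
  | nil => simp [substWord]
  | cons a w ih =>
    obtain ⟨z, b⟩ := a
    have hz := hc z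
    simp only [substWord] at ih
    cases b <;>
      simp only [substWord, List.flatMap_cons, List.length_append, List.length_cons, cond_true,
        cond_false, FreeGroup.invRev_length] <;> nlinarith

theorem even_length_substWord {u : Z → List (X × Bool)} (hu : ∀ z, Even (u z).length)
    (w : List (Z × Bool)) : Even (substWord u w).length := by
  induction w with
  | nil => simp [substWord]
  | cons a w ih =>
    obtain ⟨z, b⟩ := a
    simp only [substWord] at ih
    cases b <;>
      simp only [substWord, List.flatMap_cons, List.length_append, cond_true,
        cond_false, FreeGroup.invRev_length] <;> exact (hu z).add ih

theorem depWord_substWord_le (φ : FreeGroup X →* G) (H : Subgroup G)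
    {u : Z → List (X × Bool)} (hu : ∀ z, φ (FreeGroup.mk (u z)) ∈ H) {c : ℕ}
    (hc : ∀ z, (u z).length ≤ c) (w : List (Z × Bool)) :
    depWord φ H (substWord u w) ≤ c := by
  induction w with
  | nil => simp [substWord, depWord_nil]
  | cons a w ih =>
    obtain ⟨z, b⟩ := a
    rw [substWord, List.flatMap_cons]
    refine (depWord_append_le φ H ?_ _).trans (max_le ?_ ih)
    · cases b
      · simpa [← FreeGroup.inv_mk] using hu z
      · exact hu z
    · cases b
      · simpa using hc z
      · exact hc z

/-- Words representing given elements can be chosen such that substituting them never yields a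
null-homotopic word of odd length. -/
theorem exists_words_even (φ : FreeGroup X →* G) (hφ : Function.Surjective φ) (f : Z → G) :
    ∃ u : Z → List (X × Bool), (∀ z, φ (FreeGroup.mk (u z)) = f z) ∧
      ∀ w, φ (FreeGroup.mk (substWord u w)) = 1 → Even (substWord u w).length := by
  have hword : ∀ g, ∃ L : List (X × Bool), φ (FreeGroup.mk L) = g := fun g => by
    obtain ⟨x, rfl⟩ := hφ g
    obtain ⟨L, rfl⟩ := Quot.exists_rep x
    exact ⟨L, rfl⟩
  by_cases hodd : ∃ v : List (X × Bool), φ (FreeGroup.mk v) = 1 ∧ ¬ Even v.length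
  · obtain ⟨v, hv, hvodd⟩ := hodd
    have heven : ∀ g, ∃ L : List (X × Bool), φ (FreeGroup.mk L) = g ∧ Even L.length :=
      fun g => by
        obtain ⟨L, hL⟩ := hword g
        by_cases h : Even L.length
        · exact ⟨L, hL, h⟩
        · refine ⟨L ++ v, by rw [← FreeGroup.mul_mk, map_mul, hL, hv, mul_one], ?_⟩
          rw [List.length_append, Nat.even_add]
          tauto
    choose u hu hu' using fun z => heven (f z)
    exact ⟨u, hu, fun w _ => even_length_substWord hu' w⟩
  · push Not at hodd
    choose u hu using fun z => hword (f z)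
    exact ⟨u, hu, fun w hw => hodd _ hw⟩

end Substitution

section Rewriting

variable {X Z G : Type*} [Group G]

/-- A choice of representatives of the cosets `H * g`, with `1` representing `H`. -/
theorem exists_rightCoset_section (H : Subgroup G) :
    ∃ t : G → G, t 1 = 1 ∧ (∀ h ∈ H, ∀ g, t (h * g) = t g) ∧ ∀ g, t g * g⁻¹ ∈ H := by
  have hout : ∀ g : G, ((g⁻¹ : G) : G ⧸ H).out⁻¹ * g⁻¹ ∈ H := fun g =>
    QuotientGroup.eq.1 (Quotient.out_eq' ((g⁻¹ : G) : G ⧸ H))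
  refine ⟨fun g => ((1⁻¹ : G) : G ⧸ H).out * ((g⁻¹ : G) : G ⧸ H).out⁻¹, by simp, ?_, ?_⟩
  · intro h hh g
    have : (((h * g)⁻¹ : G) : G ⧸ H) = ((g⁻¹ : G) : G ⧸ H) :=
      QuotientGroup.eq.2 (by simpa using hh)
    simp only [this]
  · intro g
    rw [mul_assoc]
    refine H.mul_mem ?_ (hout g)
    simpa using hout 1

/-- The action of `G` on functions `G → M` by right translation of the argument. -/
def rightTranslate (G M : Type*) [Group G] [Group M] : G →* MulAut (G → M) where
  toFun a :=
    { toFun := fun f g => f (g * a)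
      invFun := fun f g => f (g * a⁻¹)
      left_inv := fun f => by simp
      right_inv := fun f => by simp
      map_mul' := fun _ _ => rfl }
  map_one' := by ext; simp
  map_mul' a b := by ext; simp [mul_assoc]

/-- Crossed homomorphisms on a free group are freely determined by their values on letters. -/
theorem exists_crossedHom {M : Type*} [Group M] (φ : FreeGroup X →* G) (c : G → X → M) :
    ∃ τ : G → FreeGroup X → M, (∀ g v w, τ g (v * w) = τ g v * τ (g * φ v) w) ∧
      ∀ g x, τ g (FreeGroup.of x) = c g x := by
  let Φ : FreeGroup X →* (G → M) ⋊[rightTranslate G M] G :=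
    FreeGroup.lift fun x => ⟨fun g => c g x, φ (FreeGroup.of x)⟩
  have hΦ : ∀ w, (Φ w).right = φ w := fun w => by
    have : SemidirectProduct.rightHom.comp Φ = φ := by
      ext x
      simp [Φ]
    exact DFunLike.congr_fun this w
  refine ⟨fun g w => (Φ w).left g, fun g v w => ?_, fun g x => by simp [Φ]⟩
  simp only [map_mul, SemidirectProduct.mul_left, ← hΦ]
  rfl

/-- Reidemeister–Schreier rewriting: a crossed homomorphism into the free group on a generating
family of `H`, constant on cosets of `H`. -/
theorem exists_rewriting (φ : FreeGroup X →* G) (H : Subgroup G) (π : FreeGroup Z →* H)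
    (hπ : Function.Surjective π) :
    ∃ τ : G → FreeGroup X → FreeGroup Z,
      (∀ g v w, τ g (v * w) = τ g v * τ (g * φ v) w) ∧
      (∀ h ∈ H, ∀ g w, τ (h * g) w = τ g w) ∧
      (∀ g w, φ w = 1 → π (τ g w) = 1) ∧
      ∀ w, φ w ∈ H → (π (τ 1 w) : G) = φ w := by
  obtain ⟨t, ht1, hth, htH⟩ := exists_rightCoset_section H
  have hσ : ∀ g : G, ∃ f : FreeGroup Z, g ∈ H → (π f : G) = g := fun g => by
    by_cases hg : g ∈ H
    · obtain ⟨f, hf⟩ := hπ ⟨g, hg⟩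
      exact ⟨f, fun _ => by rw [hf]⟩
    · exact ⟨1, fun h => absurd h hg⟩
  choose σ hσ using hσ
  obtain ⟨τ, hmul, hof⟩ := exists_crossedHom φ
    (fun g x => σ (t g * φ (FreeGroup.of x) * (t (g * φ (FreeGroup.of x)))⁻¹))
  have hone : ∀ g, τ g 1 = 1 := fun g => by
    have := hmul g 1 1
    simpa using this
  have hinv : ∀ g w, τ g w⁻¹ = (τ (g * (φ w)⁻¹) w)⁻¹ := fun g w => by
    have := hmul g w⁻¹ w
    rw [inv_mul_cancel, hone, map_inv] at this
    exact eq_inv_of_mul_eq_one_left this.symm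
  have hinvar : ∀ h ∈ H, ∀ w g, τ (h * g) w = τ g w := by
    intro h hh w
    induction w using FreeGroup.induction_on with
    | C1 => simp [hone]
    | of x => intro g; rw [hof, hof, hth h hh, mul_assoc h, hth h hh]
    | inv_of x ih => intro g; rw [hinv, hinv, mul_assoc, ih]
    | mul v w hv hw => intro g; rw [hmul, hmul, hv, mul_assoc, hw]
  have hval : ∀ w g, (π (τ g w) : G) = t g * φ w * (t (g * φ w))⁻¹ := by
    intro w
    induction w using FreeGroup.induction_on with
    | C1 => simp [hone]
    | of x =>
      intro g
      rw [hof]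
      refine hσ _ ?_
      have := H.mul_mem (htH g) (H.inv_mem (htH (g * φ (FreeGroup.of x))))
      simpa [mul_assoc] using this
    | inv_of x ih =>
      intro g
      rw [hinv, map_inv, Subgroup.coe_inv, ih]
      simp [mul_assoc]
    | mul v w hv hw =>
      intro g
      rw [hmul, map_mul, Subgroup.coe_mul, hv, hw]
      simp [mul_assoc]
  refine ⟨τ, hmul, fun h hh g w => hinvar h hh w g, fun g w hw => ?_, fun w hw => ?_⟩
  · apply Subtype.ext
    simp [hval, hw]
  · have := hth _ hw 1
    rw [mul_one, ht1] at this
    simp [hval, ht1, this]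

/-- A word in generators of `H` is changed by at most one relator `z⁻¹ * ρ z` per letter when an
endomorphism `ρ` is applied. -/
theorem exprOf_inv_mul_map {S : Set (FreeGroup Z)} (ρ : FreeGroup Z →* FreeGroup Z)
    (hρ : ∀ z, (FreeGroup.of z)⁻¹ * ρ (FreeGroup.of z) ∈ S) (w : List (Z × Bool)) :
    ExprOf S ((FreeGroup.mk w)⁻¹ * ρ (FreeGroup.mk w)) w.length := by
  induction w with
  | nil => simpa [← FreeGroup.one_eq_mk] using ExprOf.one
  | cons a w ih =>
    have hmk : (FreeGroup.mk (a :: w)) = FreeGroup.mk [a] * FreeGroup.mk w := by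
      simp [FreeGroup.mul_mk]
    have ha : ExprOf S ((FreeGroup.mk [a])⁻¹ * ρ (FreeGroup.mk [a])) 1 := by
      obtain ⟨z, b⟩ := a
      have hz : ExprOf S ((FreeGroup.of z)⁻¹ * ρ (FreeGroup.of z)) 1 :=
        ExprOf.of_mem (Or.inl (hρ z))
      cases b
      · have hneg : FreeGroup.mk [(z, false)] = (FreeGroup.of z)⁻¹ := by
          simp [FreeGroup.of, FreeGroup.inv_mk, FreeGroup.invRev]
        rw [hneg]
        convert hz.inv.conj (FreeGroup.of z) using 1
        simp [mul_assoc]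
      · exact hz
    have := (ha.conj (FreeGroup.mk w)⁻¹).mul ih
    rw [List.length_cons, add_comm, hmk]
    convert this using 1
    rw [map_mul]
    group

/-- Finitely many relators of `H` suffice to fill every relation of `H` whose image in the free
group on `X` is spelled by a word of bounded departure. -/
theorem exists_finite_relators [Finite X] [Finite Z] (R : Set (FreeGroup X)) (hRfin : R.Finite)
    (φ : FreeGroup X →* G) (hpres : Presents R φ) (H : Subgroup G)
    (K : ℕ → ℕ) (E : List (X × Bool) → List (List (X × Bool) × FreeGroup X))
    (hE : ∀ L : List (X × Bool), FreeGroup.mk L ∈ Subgroup.normalClosure R →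
      (∀ p ∈ E L, p.2 ∈ R ∨ p.2⁻¹ ∈ R) ∧
      ((E L).map fun p => FreeGroup.mk p.1 * p.2 * (FreeGroup.mk p.1)⁻¹).prod =
        FreeGroup.mk L ∧
      ∀ p ∈ E L, depWord φ H p.1 ≤ K (depWord φ H L))
    (π : FreeGroup Z →* H) (hπ : Function.Surjective π) (u : Z → List (X × Bool))
    (hu : ∀ z, φ (FreeGroup.mk (u z)) = π (FreeGroup.of z)) (B : ℕ) :
    ∃ S : Set (FreeGroup Z), S.Finite ∧ S ⊆ π.ker ∧
      ∀ (w : List (Z × Bool)) (L : List (X × Bool)), π (FreeGroup.mk w) = 1 →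
        FreeGroup.mk L = FreeGroup.mk (substWord u w) → depWord φ H L ≤ B →
        ExprOf S (FreeGroup.mk w) (w.length + (E L).length) := by
  obtain ⟨τ, hmul, hinvar, hker, hval⟩ := exists_rewriting φ H π hπ
  have hone : ∀ g, τ g 1 = 1 := fun g => by
    have := hmul g 1 1
    simpa using this
  have hRker : ∀ r, r ∈ R → φ r = 1 := fun r hr => by
    rw [← MonoidHom.mem_ker, hpres.2]
    exact subset_normalClosure hr
  obtain ⟨k, hk⟩ : ∃ k, ∀ i ≤ B, K i ≤ k :=
    ⟨(Finset.range (B + 1)).sup K, fun i hi =>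
      Finset.le_sup (Finset.mem_range.2 (Nat.lt_succ_of_le hi))⟩
  let θ : FreeGroup Z →* FreeGroup X := FreeGroup.lift fun z => FreeGroup.mk (u z)
  have hφθ : ∀ w, φ (θ w) = π w := fun w => by
    have : φ.comp θ = H.subtype.comp π := by
      ext z
      simpa [θ] using hu z
    exact DFunLike.congr_fun this w
  let ρ : FreeGroup Z →* FreeGroup Z :=
    { toFun := fun w => τ 1 (θ w)
      map_one' := by rw [map_one, hone]
      map_mul' := fun v w => by
        have hv : φ (θ v) ∈ H := by rw [hφθ]; exact (π v).2
        have := hinvar _ hv 1 (θ w)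
        rw [mul_one] at this
        rw [map_mul, hmul, one_mul, this] }
  let ball : Set G := {g | WordLe (Set.range fun x => φ (FreeGroup.of x)) g k}
  have hball : ball.Finite := WordLe.finite (Set.finite_range _) k
  refine ⟨(Set.range fun z => (FreeGroup.of z)⁻¹ * ρ (FreeGroup.of z)) ∪
    Set.image2 (fun b r => τ b⁻¹ r) ball R,
    (Set.finite_range _).union (hball.image2 _ hRfin), ?_, ?_⟩
  · rintro s (⟨z, rfl⟩ | ⟨b, -, r, hr, rfl⟩)
    · have : π (ρ (FreeGroup.of z)) = π (FreeGroup.of z) := by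
        apply Subtype.ext
        have hz := hφθ (FreeGroup.of z)
        rw [← hz]
        exact hval _ (by rw [hz]; exact (π _).2)
      simp [MonoidHom.mem_ker, this]
    · exact hker _ _ (hRker r hr)
  · intro w L hw hL hdep
    let S := (Set.range fun z => (FreeGroup.of z)⁻¹ * ρ (FreeGroup.of z)) ∪
      Set.image2 (fun b r => τ b⁻¹ r) ball R
    have hLθ : FreeGroup.mk L = θ (FreeGroup.mk w) := hL.trans (mk_substWord u w)
    obtain ⟨hER, hEprod, hEdep⟩ := hE L (by
      rw [← hpres.2, MonoidHom.mem_ker, hLθ, hφθ, hw, Subgroup.coe_one])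
    have hfill : ∀ l : List (List (X × Bool) × FreeGroup X),
        (∀ p ∈ l, (p.2 ∈ R ∨ p.2⁻¹ ∈ R) ∧ depWord φ H p.1 ≤ k) →
        ExprOf S (τ 1 (l.map fun p => FreeGroup.mk p.1 * p.2 * (FreeGroup.mk p.1)⁻¹).prod)
          l.length := by
      intro l hl
      induction l with
      | nil => simpa [hone] using ExprOf.one
      | cons p l ih =>
        obtain ⟨hpR, hpk⟩ := hl p (by simp)
        have hp1 : φ p.2 = 1 := by
          rcases hpR with h | h
          · exact hRker _ h
          · simpa using hRker _ h
        have hconj : τ 1 (FreeGroup.mk p.1 * p.2 * (FreeGroup.mk p.1)⁻¹) =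
            τ 1 (FreeGroup.mk p.1) * τ (φ (FreeGroup.mk p.1)) p.2 *
              (τ 1 (FreeGroup.mk p.1))⁻¹ := by
          have h := hmul 1 (FreeGroup.mk p.1 * p.2 * (FreeGroup.mk p.1)⁻¹) (FreeGroup.mk p.1)
          rw [inv_mul_cancel_right, hmul] at h
          simp only [map_mul, map_inv, hp1, mul_one, one_mul, mul_inv_cancel] at h
          exact eq_mul_inv_of_mul_eq h.symm
        have hrel : ExprOf S (τ (φ (FreeGroup.mk p.1)) p.2) 1 := by
          obtain ⟨h, hh, hb⟩ := exists_wordLe_of_depWord_le φ H hpk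
          have hmem : ∀ r ∈ R, τ (φ (FreeGroup.mk p.1)) r ∈ S := fun r hr => by
            refine Or.inr ⟨_, hb, r, hr, ?_⟩
            simpa using hinvar _ (H.inv_mem hh) (φ (FreeGroup.mk p.1)) r
          refine ExprOf.of_mem (hpR.imp (hmem _) fun h => ?_)
          have h2 := hmul (φ (FreeGroup.mk p.1)) p.2 p.2⁻¹
          rw [mul_inv_cancel, hone, hp1, mul_one] at h2
          rw [inv_eq_of_mul_eq_one_right h2.symm]
          exact hmem _ h
        have := (hrel.conj (τ 1 (FreeGroup.mk p.1))).mul (ih fun q hq => hl q (by simp [hq]))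
        rw [List.length_cons, add_comm, List.map_cons, List.prod_cons, hmul, hconj]
        simpa [hp1, -FreeGroup.inv_mk] using this
    have h1 := hfill (E L) fun p hp => ⟨hER p hp, (hEdep p hp).trans (hk _ hdep)⟩
    rw [hEprod, hLθ] at h1
    have h2 := exprOf_inv_mul_map (S := S) ρ (fun z => Or.inl ⟨z, rfl⟩) w
    have h3 := h1.mul h2.inv
    rw [add_comm]
    convert h3 using 1
    rw [mul_inv_rev, inv_inv]
    exact (mul_inv_cancel_left _ _).symm

end Rewriting

/-- If every null-homotopic word over a finite presentation of `G` admits a filling expression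
whose departure from `H` is controlled by the departure of the word, then `H` is finitely
presented; and if the areas of the expressions are bounded by `α`, then `α` is an
isoperimetric function for `H`. -/
theorem close_fillings_give_finite_presentation {G : Type} [Group G]
    {X : Type} [Finite X] (R : Set (FreeGroup X)) (hRfin : R.Finite)
    (φ : FreeGroup X →* G) (hpres : Presents R φ)
    (H : Subgroup G) (Y : Set H) (hYfin : Y.Finite) (hYgen : Subgroup.closure Y = ⊤)
    (K : ℕ → ℕ) (E : List (X × Bool) → List (List (X × Bool) × FreeGroup X))
    (hE : ∀ L : List (X × Bool), FreeGroup.mk L ∈ Subgroup.normalClosure R →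
      (∀ p ∈ E L, p.2 ∈ R ∨ p.2⁻¹ ∈ R) ∧
      ((E L).map fun p => FreeGroup.mk p.1 * p.2 * (FreeGroup.mk p.1)⁻¹).prod =
        FreeGroup.mk L ∧
      ∀ p ∈ E L, depWord φ H p.1 ≤ K (depWord φ H L)) :
    (∃ S : Set (FreeGroup Y), S.Finite ∧
        Presents S (FreeGroup.lift fun y : Y => (y : H))) ∧
      ∀ α : ℕ → ℕ,
        (∀ L : List (X × Bool), FreeGroup.mk L ∈ Subgroup.normalClosure R →
          (E L).length ≤ α L.length) →
        IsIsopFunction H α := by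
  have hnull : ∀ (Z : Type) (π : FreeGroup Z →* H) (u : Z → List (X × Bool)),
      (∀ z, φ (FreeGroup.mk (u z)) = π (FreeGroup.of z)) → ∀ w : List (Z × Bool),
      φ (FreeGroup.mk (substWord u w)) = π (FreeGroup.mk w) := by
    intro Z π u hu w
    rw [mk_substWord]
    have : φ.comp (FreeGroup.lift fun z => FreeGroup.mk (u z)) = H.subtype.comp π := by
      ext z
      simpa using hu z
    exact DFunLike.congr_fun this _
  have hrel := fun (Z : Type) (_ : Finite Z) =>
    exists_finite_relators (Z := Z) R hRfin φ hpres H K E hE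
  constructor
  · have : Finite Y := hYfin
    set π : FreeGroup Y →* H := FreeGroup.lift fun y : Y => (y : H) with hπdef
    have hπ : Function.Surjective π := by
      rw [← MonoidHom.range_eq_top, hπdef, FreeGroup.range_lift_eq_closure, Subtype.range_coe]
      exact hYgen
    obtain ⟨u, hu, -⟩ := exists_words_even φ hpres.1 fun y : Y => (π (FreeGroup.of y) : G)
    obtain ⟨c, hc⟩ := (Set.finite_range fun y => (u y).length).bddAbove
    have hc' : ∀ y, (u y).length ≤ c := fun y => hc ⟨y, rfl⟩
    obtain ⟨S, hSfin, hSker, hS⟩ := hrel Y this π hπ u hu c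
    refine ⟨S, hSfin, hπ, le_antisymm (fun w hw => ?_) (normalClosure_le_normal hSker)⟩
    obtain ⟨w, rfl⟩ := Quot.exists_rep w
    exact (hS w _ hw rfl
      (depWord_substWord_le φ H (fun y => by rw [hu]; exact (π _).2) hc' w)).mem_normalClosure
  · intro α hα Z R' π hZ _ hpres'
    obtain ⟨u, hu, heven⟩ := exists_words_even φ hpres.1 fun z : Z => (π (FreeGroup.of z) : G)
    obtain ⟨c, hc⟩ := (Set.finite_range fun z => (u z).length).bddAbove
    have hc' : ∀ z, (u z).length ≤ c := fun z => hc ⟨z, rfl⟩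
    have huH : ∀ z, φ (FreeGroup.mk (u z)) ∈ H := fun z => by rw [hu]; exact (π _).2
    obtain ⟨S, hSfin, hSker, hS⟩ := hrel Z hZ π hpres'.1 u hu (max 2 c)
    rw [hpres'.2] at hSker
    obtain ⟨A, hA⟩ := ExprOf.exists_area_le_mul hSfin hSker
    obtain ⟨C, hC⟩ : ∃ C : ℕ, ∀ (l : ℕ) (w : List (Z × Bool)), w.length ≤ l →
        π (FreeGroup.mk w) = 1 →
        area R' (FreeGroup.mk w) ≤ C * α (C * l + C) + C * l + C := by
      rcases isEmpty_or_nonempty X with hX | hX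
      · refine ⟨A + A * (E []).length, fun l w hl hw => ?_⟩
        have hnil : substWord u w = [] :=
          List.eq_nil_iff_forall_not_mem.2 fun a => (hX.false a.1).elim
        have := hA _ _ (hS w [] hw (by rw [hnil]) (by simp [depWord_nil]))
        refine this.trans ?_
        have hAl := Nat.mul_le_mul_left A hl
        have : A * l ≤ (A + A * (E []).length) * l := Nat.mul_le_mul_right l (by omega)
        rw [mul_add]
        omega
      · refine ⟨2 * (A + c), fun l w hl hw => ?_⟩
        have hφw : φ (FreeGroup.mk (substWord u w)) = 1 := by
          rw [hnull Z π u hu, hw, Subgroup.coe_one]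
        have hlen : (substWord u w).length ≤ 2 * (A + c) * l + 2 * (A + c) := by
          have h1 := length_substWord_le hc' w
          have h2 := Nat.mul_le_mul_left c hl
          nlinarith
        obtain ⟨k, hk⟩ : ∃ k, 2 * (A + c) * l + 2 * (A + c) =
            (substWord u w).length + 2 * k := by
          obtain ⟨m, hm⟩ := heven w hφw
          refine ⟨(A + c) * l + (A + c) - m, ?_⟩
          have : 2 * (A + c) * l = 2 * ((A + c) * l) := mul_assoc _ _ _
          omega
        obtain ⟨L, hmk, hLlen, hLdep⟩ := exists_padding φ H (substWord u w) k
        have hdep : depWord φ H L ≤ max 2 c :=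
          hLdep.trans (max_le_max le_rfl (depWord_substWord_le φ H huH hc' w))
        have h1 := hA _ _ (hS w L hw hmk hdep)
        have h2 := hα L (by rw [← hpres.2, MonoidHom.mem_ker, hmk, hφw])
        rw [hLlen, ← hk] at h2
        have h3 := Nat.mul_le_mul_left A (Nat.add_le_add hl h2)
        have h4 : A * (l + α (2 * (A + c) * l + 2 * (A + c))) ≤
            2 * (A + c) * (l + α (2 * (A + c) * l + 2 * (A + c))) :=
          Nat.mul_le_mul_right _ (by omega)
        refine (h1.trans (h3.trans h4)).trans ?_
        rw [mul_add]
        omega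
    refine ⟨C, fun l => csSup_le' ?_⟩
    rintro _ ⟨w, hw, hwl, rfl⟩
    classical
    have hl : w.toWord.length ≤ l := by
      refine le_trans (le_of_eq ?_) hwl
      unfold fgNorm FreeGroup.norm
      congr!
    have := hC l w.toWord hl (by
      rw [FreeGroup.mk_toWord, ← MonoidHom.mem_ker, hpres'.2]
      exact hw)
    rwa [FreeGroup.mk_toWord] at this
end

section
/- Suppose n ≥ 2 and r ≥ 1. Let M = K^{n-1}_m(r) ≤ F^{(1)}_m × … × F^{(n-1)}_m, and for each 1 ≤ k ≤ r let L_k ≤ F^{(1)}_m × … × F^{(n-1)}_m be the kernel of the homomorphism θ_k : F^{(1)}_m × … × F^{(n-1)}_m → ℤ^{r-1} determined by θ_k(e_j^{(i)}) = t_j for 1 ≤ j ≤ k-1, θ_k(e_k^{(i)}) = 0, θ_k(e_j^{(i)}) = t_{j-1} for k+1 ≤ j ≤ r, and θ_k(e_j^{(i)}) = 0 for r+1 ≤ j ≤ m. Then M ≤ L_k for each k, each L_k is isomorphic to K^{n-1}_m(r-1), and K^n_m(r) is isomorphic to the amalgamated free product over M of the r+1 groups L_1, …, L_r and M × F_{m-r},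 amalgamated along the inclusions M ↪ L_k and the inclusion of M as the first factor of M × F_{m-r}, where F_{m-r} is a free group of rank m − r. -/
/-- The homomorphism `F_m → ℤ^r` sending the `j`-th basis element to `t_j` for `j < r`
and to `0` otherwise. -/
def thetaComp (m r : ℕ) : FreeGroup (Fin m) →* Multiplicative (Fin r → ℤ) :=
  FreeGroup.lift fun j =>
    Multiplicative.ofAdd (if h : (j : ℕ) < r then Pi.single (⟨j, h⟩ : Fin r) (1 : ℤ) else 0)

/-- The homomorphism `θ : F_m^{(1)} × … × F_m^{(N)} → ℤ^r` with `θ(e_j^{(i)}) = t_j` for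
`j < r` and `θ(e_j^{(i)}) = 0` otherwise.  Its kernel is `K^N_m(r)`. -/
def theta (N m r : ℕ) : (Fin N → FreeGroup (Fin m)) →* Multiplicative (Fin r → ℤ) :=
  MonoidHom.noncommPiCoprod (fun _ : Fin N => thetaComp m r)
    (fun {_ _} _ _ _ => Commute.all _ _)

/-- The component of `θ_k` on each free factor: the `j`-th basis element is sent to `t_j`
for `j < k`, to `0` for `j = k`, to `t_{j-1}` for `k < j < r`, and to `0` for `j ≥ r`
(0-based indexing). -/
def thetaKComp (m r : ℕ) (k : Fin r) :
    FreeGroup (Fin m) →* Multiplicative (Fin (r - 1) → ℤ) :=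
  FreeGroup.lift fun j =>
    Multiplicative.ofAdd <|
      if hj : (j : ℕ) < (k : ℕ) then
        Pi.single (⟨j, by have := k.isLt; omega⟩ : Fin (r - 1)) (1 : ℤ)
      else if hj2 : (j : ℕ) = (k : ℕ) then 0
      else if hj3 : (j : ℕ) < r then
        Pi.single (⟨(j : ℕ) - 1, by omega⟩ : Fin (r - 1)) (1 : ℤ)
      else 0

/-- The homomorphism `θ_k : F_m^{(1)} × … × F_m^{(N)} → ℤ^{r-1}`; its kernel is `L_k`. -/
def thetaK (N m r : ℕ) (k : Fin r) :
    (Fin N → FreeGroup (Fin m)) →* Multiplicative (Fin (r - 1) → ℤ) :=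
  MonoidHom.noncommPiCoprod (fun _ : Fin N => thetaKComp m r k)
    (fun {_ _} _ _ _ => Commute.all _ _)

/-- The family of groups being amalgamated: `L_k = ker θ_k` for `k = 1, …, r`, together with
`M × F_{m-r}` where `M = K^{n-1}_m(r)`. -/
def Gfam (n m r : ℕ) (o : Option (Fin r)) : Type :=
  Option.rec (↥((theta (n - 1) m r).ker) × FreeGroup (Fin (m - r)))
    (fun k => ↥((thetaK (n - 1) m r k).ker)) o

instance GfamGroup (n m r : ℕ) : (o : Option (Fin r)) → Group (Gfam n m r o)
  | none =>
    inferInstanceAs (Group (↥((theta (n - 1) m r).ker) × FreeGroup (Fin (m - r))))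
  | some k => inferInstanceAs (Group ↥((thetaK (n - 1) m r k).ker))

/-- The amalgamating inclusions: `M ↪ L_k`, and `M ↪ M × F_{m-r}` as the first factor. -/
def phifam (n m r : ℕ)
    (hML : ∀ k : Fin r, (theta (n - 1) m r).ker ≤ (thetaK (n - 1) m r k).ker) :
    (o : Option (Fin r)) → ↥((theta (n - 1) m r).ker) →* Gfam n m r o
  | none => MonoidHom.inl ↥((theta (n - 1) m r).ker) (FreeGroup (Fin (m - r)))
  | some k => Subgroup.inclusion (hML k)

section Kernels

/-- An isomorphism matching the kernels of two homomorphisms restricts to the kernels. -/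
def MulEquiv.kerCongr {G H X Y : Type*} [Group G] [Group H] [Group X] [Group Y]
    (e : G ≃* H) (f : G →* X) (g : H →* Y) (h : ∀ x, f x = 1 ↔ g (e x) = 1) :
    f.ker ≃* g.ker where
  toEquiv := e.toEquiv.subtypeEquiv h
  map_mul' x y := Subtype.ext (map_mul e (x : G) y)

theorem theta_apply (N m r : ℕ) (x : Fin N → FreeGroup (Fin m)) :
    theta N m r x = ∏ i, thetaComp m r (x i) := by
  exact Finset.noncommProd_eq_prod Finset.univ fun i => thetaComp m r (x i)

theorem thetaK_apply (N m r : ℕ) (k : Fin r) (x : Fin N → FreeGroup (Fin m)) :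
    thetaK N m r k x = ∏ i, thetaKComp m r k (x i) := by
  exact Finset.noncommProd_eq_prod Finset.univ fun i => thetaKComp m r k (x i)

theorem theta_mulSingle (N m r : ℕ) (i : Fin N) (f : FreeGroup (Fin m)) :
    theta N m r (Pi.mulSingle i f) = thetaComp m r f :=
  MonoidHom.noncommPiCoprod_mulSingle (N := fun _ : Fin N => FreeGroup (Fin m))
    (fun _ => thetaComp m r) i f

/-- The order embedding of `Fin (r - 1)` in `Fin r` that omits `k`. -/
def skipIndex {r : ℕ} (k : Fin r) (i : Fin (r - 1)) : Fin r :=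
  if (i : ℕ) < k then ⟨i, by omega⟩ else ⟨i + 1, by omega⟩

/-- The projection `ℤ^r → ℤ^{r-1}` that forgets the `k`-th coordinate. -/
def dropCoord {r : ℕ} (k : Fin r) :
    Multiplicative (Fin r → ℤ) →* Multiplicative (Fin (r - 1) → ℤ) :=
  AddMonoidHom.toMultiplicative
    { toFun := fun v i => v (skipIndex k i)
      map_zero' := rfl
      map_add' := fun _ _ => rfl }

theorem thetaKComp_eq (m r : ℕ) (k : Fin r) :
    thetaKComp m r k = (dropCoord k).comp (thetaComp m r) := by
  ext j : 1
  apply Multiplicative.toAdd.injective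
  funext i
  simp only [thetaKComp, thetaComp, dropCoord, skipIndex, FreeGroup.lift_apply_of,
    MonoidHom.comp_apply, AddMonoidHom.toMultiplicative_apply_apply, toAdd_ofAdd,
    AddMonoidHom.coe_mk, ZeroHom.coe_mk]
  have := k.isLt
  split_ifs <;> simp only [Pi.single_apply, Fin.ext_iff, Pi.zero_apply] <;>
    split_ifs <;> first | rfl | omega

theorem thetaK_eq (N m r : ℕ) (k : Fin r) (x : Fin N → FreeGroup (Fin m)) :
    thetaK N m r k x = dropCoord k (theta N m r x) := by
  simp [thetaK_apply, theta_apply, thetaKComp_eq, map_prod]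

theorem ker_theta_le_ker_thetaK (N m r : ℕ) (k : Fin r) :
    (theta N m r).ker ≤ (thetaK N m r k).ker := fun x hx => by
  rw [MonoidHom.mem_ker] at hx ⊢
  rw [thetaK_eq, hx, map_one]

theorem eq_single_of_dropCoord_eq_one {r : ℕ} (k : Fin r) (v : Multiplicative (Fin r → ℤ))
    (h : dropCoord k v = 1) :
    v = Multiplicative.ofAdd (Pi.single k (Multiplicative.toAdd v k)) := by
  apply Multiplicative.toAdd.injective
  funext j
  rw [toAdd_ofAdd, Pi.single_apply]
  split_ifs with hj
  · rw [hj]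
  · have hi : (if (j : ℕ) < k then (j : ℕ) else j - 1) < r - 1 := by
      have : (j : ℕ) ≠ k := fun h => hj (Fin.ext h)
      split_ifs <;> omega
    have hs : skipIndex k ⟨_, hi⟩ = j := by
      have : (j : ℕ) ≠ k := fun h => hj (Fin.ext h)
      ext
      simp only [skipIndex]
      split_ifs <;> simp <;> omega
    have := congrFun (congrArg Multiplicative.toAdd h) ⟨_, hi⟩
    change Multiplicative.toAdd v (skipIndex k ⟨_, hi⟩) = 0 at this
    rwa [hs] at this

/-- The permutation of `Fin m` that moves `k` to position `r - 1` and shifts the indices between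
`k` and `r - 1` down by one. -/
noncomputable def shiftPerm {m r : ℕ} (hrm : r ≤ m) (k : Fin r) : Equiv.Perm (Fin m) :=
  Equiv.ofBijective
    (fun j => ⟨if (j : ℕ) < k then j else if (j : ℕ) = k then r - 1
      else if (j : ℕ) < r then j - 1 else j, by split_ifs <;> omega⟩)
    (Function.Injective.bijective_of_finite fun a b h => by
      have h := Fin.mk.inj h
      ext
      split_ifs at h <;> omega)

theorem thetaComp_shiftPerm {m r : ℕ} (hrm : r ≤ m) (k : Fin r) (f : FreeGroup (Fin m)) :
    thetaComp m (r - 1) (FreeGroup.freeGroupCongr (shiftPerm hrm k) f) = thetaKComp m r k f := by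
  suffices (thetaComp m (r - 1)).comp
      (FreeGroup.freeGroupCongr (shiftPerm hrm k)).toMonoidHom = thetaKComp m r k from
    DFunLike.congr_fun this f
  ext j : 1
  apply Multiplicative.toAdd.injective
  funext i
  have := k.isLt
  simp only [thetaKComp, thetaComp, FreeGroup.lift_apply_of, MonoidHom.comp_apply,
    MulEquiv.toMonoidHom_eq_coe, MonoidHom.coe_coe, FreeGroup.freeGroupCongr_apply,
    FreeGroup.map.of, toAdd_ofAdd, shiftPerm, Equiv.ofBijective_apply]
  split_ifs <;> first | rfl | omega

/-- Permuting the basis of each free factor identifies `L_k` with `K^N_m(r-1)`. -/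
noncomputable def kerThetaKEquiv (N : ℕ) {m r : ℕ} (hrm : r ≤ m) (k : Fin r) :
    (thetaK N m r k).ker ≃* (theta N m (r - 1)).ker :=
  (MulEquiv.piCongrRight fun _ : Fin N =>
    FreeGroup.freeGroupCongr (shiftPerm hrm k)).kerCongr _ _ fun x => by
      simp [thetaK_apply, theta_apply, thetaComp_shiftPerm, -FreeGroup.freeGroupCongr_apply]

/-- The kernel of `θ` on `A × F_m`, where `A` is the product of the first `N` free factors. -/
abbrev pairKer (N m r : ℕ) : Subgroup ((Fin N → FreeGroup (Fin m)) × FreeGroup (Fin m)) :=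
  ((theta N m r).coprod (thetaComp m r)).ker

theorem mem_pairKer {N m r : ℕ} {p : (Fin N → FreeGroup (Fin m)) × FreeGroup (Fin m)} :
    p ∈ pairKer N m r ↔ theta N m r p.1 * thetaComp m r p.2 = 1 := by
  rw [MonoidHom.mem_ker, MonoidHom.coprod_apply]

/-- Splitting off the last free factor. -/
def kerThetaSuccEquiv (N m r : ℕ) : (theta (N + 1) m r).ker ≃* pairKer N m r :=
  MulEquiv.kerCongr
    { toFun := fun x => (fun i => x i.castSucc, x (Fin.last N))
      invFun := fun p => Fin.snoc p.1 p.2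
      left_inv := fun x => by
        funext i
        refine Fin.lastCases ?_ (fun i => ?_) i <;> simp
      right_inv := fun p => by simp
      map_mul' := fun _ _ => rfl } _ _ fun x => by
    simp [theta_apply, Fin.prod_univ_castSucc]

end Kernels

section Splitting

open Monoid

variable {n m r : ℕ}

/-- The inclusion `F_{m-r} → F_m` onto the free factor generated by the last `m - r` basis
elements. -/
def tailHom (hrm : r ≤ m) : FreeGroup (Fin (m - r)) →* FreeGroup (Fin m) :=
  FreeGroup.map fun j => ⟨r + j, by omega⟩

theorem thetaComp_tailHom (hrm : r ≤ m) (w : FreeGroup (Fin (m - r))) :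
    thetaComp m r (tailHom hrm w) = 1 := by
  suffices (thetaComp m r).comp (tailHom hrm) = 1 from DFunLike.congr_fun this w
  ext j : 1
  simp [thetaComp, tailHom]

/-- The homomorphism `F_m → F_m` sending `e_j` to `e_j⁻¹` for `j < r` and to `1` otherwise. -/
def invHom (m r : ℕ) : FreeGroup (Fin m) →* FreeGroup (Fin m) :=
  FreeGroup.lift fun j => if (j : ℕ) < r then (FreeGroup.of j)⁻¹ else 1

theorem thetaComp_invHom (f : FreeGroup (Fin m)) :
    thetaComp m r (invHom m r f) = (thetaComp m r f)⁻¹ := by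
  suffices (thetaComp m r).comp (invHom m r) = (thetaComp m r)⁻¹ from DFunLike.congr_fun this f
  ext j : 1
  by_cases h : (j : ℕ) < r <;> simp [thetaComp, invHom, h]

theorem invHom_tailHom (hrm : r ≤ m) (w : FreeGroup (Fin (m - r))) :
    invHom m r (tailHom hrm w) = 1 := by
  suffices (invHom m r).comp (tailHom hrm) = 1 from DFunLike.congr_fun this w
  ext j : 1
  simp [invHom, tailHom]

/-- The basis element `e_k` of `F_m`, for `k < r ≤ m`. -/
def gen (hrm : r ≤ m) (k : Fin r) : FreeGroup (Fin m) := FreeGroup.of (k.castLE hrm)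

theorem thetaComp_gen (hrm : r ≤ m) (k : Fin r) :
    thetaComp m r (gen hrm k) = Multiplicative.ofAdd (Pi.single k 1) := by
  simp [thetaComp, gen]

theorem invHom_gen (hrm : r ≤ m) (k : Fin r) : invHom m r (gen hrm k) = (gen hrm k)⁻¹ := by
  simp [invHom, gen]

variable (i₀ : Fin (n - 1))

/-- The section `F_m → A` used to split `K^n_m(r) → F_m`, with image in the `i₀`-th factor. -/
def sectionHom (m r : ℕ) : FreeGroup (Fin m) →* (Fin (n - 1) → FreeGroup (Fin m)) :=
  (MonoidHom.mulSingle (fun _ => FreeGroup (Fin m)) i₀).comp (invHom m r)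

theorem theta_sectionHom (f : FreeGroup (Fin m)) :
    theta (n - 1) m r (sectionHom i₀ m r f) = (thetaComp m r f)⁻¹ := by
  simp [sectionHom, theta_mulSingle, thetaComp_invHom]

/-- The basis element `e_k` of the `i₀`-th free factor, as an element of `L_k`. -/
def genL (hrm : r ≤ m) (k : Fin r) : (thetaK (n - 1) m r k).ker :=
  ⟨Pi.mulSingle i₀ (gen hrm k), by
    rw [MonoidHom.mem_ker, thetaK_eq, theta_mulSingle, thetaComp_gen]
    apply Multiplicative.toAdd.injective
    funext i
    change (Pi.single k 1 : Fin r → ℤ) (skipIndex k i) = 0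
    rw [Pi.single_apply, if_neg]
    simp only [skipIndex]
    split_ifs <;> simp [Fin.ext_iff] <;> omega⟩

theorem sectionHom_gen (hrm : r ≤ m) (k : Fin r) :
    sectionHom i₀ m r (gen hrm k) = ((genL i₀ hrm k)⁻¹ : (thetaK (n - 1) m r k).ker) := by
  simp [sectionHom, invHom_gen, genL, Pi.mulSingle_inv]

/-- The exponent of the `k`-th coordinate, as a homomorphism. -/
def coordHom (n m : ℕ) (k : Fin r) :
    (Fin (n - 1) → FreeGroup (Fin m)) →* Multiplicative ℤ :=
  (AddMonoidHom.toMultiplicative (Pi.evalAddMonoidHom (fun _ : Fin r => ℤ) k)).comp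
    (theta (n - 1) m r)

theorem theta_eq_gen_zpow (hrm : r ≤ m) (k : Fin r) (a : (thetaK (n - 1) m r k).ker) :
    theta (n - 1) m r a =
      thetaComp m r (gen hrm k) ^ Multiplicative.toAdd (coordHom n m k (a : _)) := by
  have h := a.2
  rw [MonoidHom.mem_ker, thetaK_eq] at h
  rw [thetaComp_gen, ← ofAdd_zsmul]
  refine (eq_single_of_dropCoord_eq_one k _ h).trans ?_
  congr 1
  funext j
  simp [Pi.single_apply, coordHom]

/-- The embedding of `L_k` in `K^n_m(r)`. -/
def embL (n : ℕ) (hrm : r ≤ m) (k : Fin r) :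
    (thetaK (n - 1) m r k).ker →* pairKer (n - 1) m r :=
  ((thetaK (n - 1) m r k).ker.subtype.prod
    (((zpowersHom _ (gen hrm k)⁻¹).comp (coordHom n m k)).comp
      (thetaK (n - 1) m r k).ker.subtype)).codRestrict _ fun a => by
    simp [theta_eq_gen_zpow hrm k a]

/-- The embedding of `M × F_{m-r}` in `K^n_m(r)`. -/
def embTail (n : ℕ) (hrm : r ≤ m) :
    (theta (n - 1) m r).ker × FreeGroup (Fin (m - r)) →* pairKer (n - 1) m r :=
  ((theta (n - 1) m r).ker.subtype.prodMap (tailHom hrm)).codRestrict _ fun p => by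
    have h : theta (n - 1) m r p.1 = 1 := p.1.2
    simp [thetaComp_tailHom, h]

/-- The embeddings of the amalgamated groups in `K^n_m(r)`. -/
def famHom (n : ℕ) (hrm : r ≤ m) : (o : Option (Fin r)) → Gfam n m r o →* pairKer (n - 1) m r
  | none => embTail n hrm
  | some k => embL n hrm k

/-- The embedding of `M` in `K^n_m(r)`. -/
def baseHom (n m r : ℕ) : (theta (n - 1) m r).ker →* pairKer (n - 1) m r :=
  ((MonoidHom.inl _ _).comp (theta (n - 1) m r).ker.subtype).codRestrict _ fun x => by
    have h : theta (n - 1) m r x = 1 := x.2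
    simp [h]

variable (hML : ∀ k : Fin r, (theta (n - 1) m r).ker ≤ (thetaK (n - 1) m r k).ker)

/-- The homomorphism from the amalgamated product to `K^n_m(r)`. -/
def pushoutHom (hrm : r ≤ m) : PushoutI (phifam n m r hML) →* pairKer (n - 1) m r :=
  PushoutI.lift (famHom n hrm) (baseHom n m r) fun o => by
    ext x : 2
    cases o with
    | none => exact Prod.ext rfl (map_one (tailHom hrm))
    | some k =>
      refine Prod.ext rfl ?_
      have h : theta (n - 1) m r x = 1 := x.2
      change (zpowersHom _ (gen hrm k)⁻¹) (coordHom n m k x) = 1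
      simp [coordHom, h]

/-- The map from `L_k` to the amalgamated product. -/
def ofL (k : Fin r) : (thetaK (n - 1) m r k).ker →* PushoutI (phifam n m r hML) :=
  PushoutI.of (φ := phifam n m r hML) (some k)

/-- The map from `M × F_{m-r}` to the amalgamated product. -/
def ofTail : (theta (n - 1) m r).ker × FreeGroup (Fin (m - r)) →* PushoutI (phifam n m r hML) :=
  PushoutI.of (φ := phifam n m r hML) none

theorem ofL_inclusion (k : Fin r) (y : (theta (n - 1) m r).ker) :
    ofL hML k (Subgroup.inclusion (hML k) y) = PushoutI.base (phifam n m r hML) y :=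
  PushoutI.of_apply_eq_base (phifam n m r hML) (some k) y

theorem ofTail_mk_one (y : (theta (n - 1) m r).ker) :
    ofTail hML (y, 1) = PushoutI.base (phifam n m r hML) y :=
  PushoutI.of_apply_eq_base (phifam n m r hML) none y

theorem pushoutHom_ofL (hrm : r ≤ m) (k : Fin r) (a : (thetaK (n - 1) m r k).ker) :
    pushoutHom hML hrm (ofL hML k a) = embL n hrm k a :=
  PushoutI.lift_of (φ := phifam n m r hML) (i := some k) _ _ _ a

theorem pushoutHom_ofTail (hrm : r ≤ m)
    (p : (theta (n - 1) m r).ker × FreeGroup (Fin (m - r))) :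
    pushoutHom hML hrm (ofTail hML p) = embTail n hrm p :=
  PushoutI.lift_of (φ := phifam n m r hML) (i := none) _ _ _ p

/-- The homomorphism from `F_m` to the amalgamated product that splits the projection to `F_m`. -/
def freeHom (hrm : r ≤ m) : FreeGroup (Fin m) →* PushoutI (phifam n m r hML) :=
  FreeGroup.lift fun j =>
    if h : (j : ℕ) < r then (ofL hML ⟨j, h⟩ (genL i₀ hrm ⟨j, h⟩))⁻¹
    else ofTail hML (1, FreeGroup.of ⟨j - r, by omega⟩)

theorem freeHom_gen (hrm : r ≤ m) (k : Fin r) :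
    freeHom i₀ hML hrm (gen hrm k) = (ofL hML k (genL i₀ hrm k))⁻¹ := by
  simp [freeHom, gen]

theorem freeHom_tailHom (hrm : r ≤ m) (w : FreeGroup (Fin (m - r))) :
    freeHom i₀ hML hrm (tailHom hrm w) = ofTail hML (1, w) := by
  suffices (freeHom i₀ hML hrm).comp (tailHom hrm) =
      (ofTail hML).comp (MonoidHom.inr _ _) from
    DFunLike.congr_fun this w
  ext j : 1
  simp [freeHom, tailHom]

/-- Conjugation of `M` by `sectionHom`. -/
def conjM (f : FreeGroup (Fin m)) (y : (theta (n - 1) m r).ker) : (theta (n - 1) m r).ker :=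
  ⟨sectionHom i₀ m r f * y * (sectionHom i₀ m r f)⁻¹,
    (MonoidHom.normal_ker (theta (n - 1) m r)).conj_mem _ y.2 _⟩

theorem eq_gen_or_eq_tailHom (hrm : r ≤ m) (j : Fin m) :
    (∃ k, FreeGroup.of j = gen hrm k) ∨ ∃ l, FreeGroup.of j = tailHom hrm (FreeGroup.of l) := by
  by_cases h : (j : ℕ) < r
  · exact Or.inl ⟨⟨j, h⟩, rfl⟩
  · refine Or.inr ⟨⟨j - r, by omega⟩, ?_⟩
    simp only [tailHom, FreeGroup.map.of]
    congr 1
    ext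
    simp only
    omega

theorem freeHom_mul_base (hrm : r ≤ m) (f : FreeGroup (Fin m)) (y : (theta (n - 1) m r).ker) :
    freeHom i₀ hML hrm f * PushoutI.base (phifam n m r hML) y =
      PushoutI.base (phifam n m r hML) (conjM i₀ f y) * freeHom i₀ hML hrm f := by
  induction f using FreeGroup.induction_on generalizing y with
  | C1 =>
    have : conjM i₀ 1 y = y := Subtype.ext (by simp [conjM])
    simp [this]
  | of j =>
    rcases eq_gen_or_eq_tailHom hrm j with ⟨k, hk⟩ | ⟨l, hl⟩
    · rw [hk, freeHom_gen, inv_mul_eq_iff_eq_mul, ← mul_assoc, eq_mul_inv_iff_mul_eq,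
        ← ofL_inclusion hML k, ← ofL_inclusion hML k, ← map_mul, ← map_mul]
      congr 1
      apply Subtype.ext
      change (y : Fin (n - 1) → FreeGroup (Fin m)) * (genL i₀ hrm k : _) =
        (genL i₀ hrm k : _) * (sectionHom i₀ m r (gen hrm k) * y *
          (sectionHom i₀ m r (gen hrm k))⁻¹)
      rw [sectionHom_gen]
      simp [mul_assoc]
    · have : conjM i₀ (tailHom hrm (FreeGroup.of l)) y = y :=
        Subtype.ext (by simp [conjM, sectionHom, invHom_tailHom])
      rw [hl, this, freeHom_tailHom, ← ofTail_mk_one, ← map_mul, ← map_mul]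
      simp
  | inv_of j h =>
    have h' := h (conjM i₀ (FreeGroup.of j)⁻¹ y)
    have : conjM i₀ (FreeGroup.of j) (conjM i₀ (FreeGroup.of j)⁻¹ y) = y :=
      Subtype.ext (by simp [conjM, mul_assoc])
    change freeHom i₀ hML hrm (FreeGroup.of j) * _ =
      PushoutI.base _ (conjM i₀ (FreeGroup.of j) _) * freeHom i₀ hML hrm (FreeGroup.of j) at h'
    rw [this] at h'
    change freeHom i₀ hML hrm (FreeGroup.of j)⁻¹ * _ =
      PushoutI.base _ (conjM i₀ (FreeGroup.of j)⁻¹ _) * freeHom i₀ hML hrm (FreeGroup.of j)⁻¹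
    rw [map_inv, inv_mul_eq_iff_eq_mul, ← mul_assoc, h', mul_inv_cancel_right]
  | mul f g hf hg =>
    have : conjM i₀ (f * g) y = conjM i₀ f (conjM i₀ g y) :=
      Subtype.ext (by simp [conjM, mul_assoc])
    rw [map_mul, mul_assoc, hg, ← mul_assoc, hf, mul_assoc, this]

/-- The `M`-component of an element of `K^n_m(r)`, viewed as `M ⋊ F_m`. -/
def kerPart (p : pairKer (n - 1) m r) : (theta (n - 1) m r).ker :=
  ⟨p.1.1 * (sectionHom i₀ m r p.1.2)⁻¹, by
    rw [MonoidHom.mem_ker, map_mul, map_inv, theta_sectionHom, inv_inv]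
    exact mem_pairKer.1 p.2⟩

/-- The homomorphism from `K^n_m(r)` to the amalgamated product. -/
def toPushout (hrm : r ≤ m) : pairKer (n - 1) m r →* PushoutI (phifam n m r hML) :=
  MonoidHom.mk' (fun p => PushoutI.base _ (kerPart i₀ p) * freeHom i₀ hML hrm p.1.2)
    fun p q => by
      have : kerPart i₀ (p * q) = kerPart i₀ p * conjM i₀ p.1.2 (kerPart i₀ q) :=
        Subtype.ext (by simp [kerPart, conjM, mul_assoc])
      rw [this, map_mul, Subgroup.coe_mul, Prod.snd_mul, map_mul, mul_assoc, mul_assoc,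
        ← mul_assoc (freeHom i₀ hML hrm _), freeHom_mul_base]
      simp only [mul_assoc]

theorem pushoutHom_freeHom (hrm : r ≤ m) (f : FreeGroup (Fin m)) :
    (pushoutHom hML hrm (freeHom i₀ hML hrm f) : _ × _) = (sectionHom i₀ m r f, f) := by
  suffices (pairKer (n - 1) m r).subtype.comp ((pushoutHom hML hrm).comp (freeHom i₀ hML hrm)) =
      (sectionHom i₀ m r).prod (MonoidHom.id _) from DFunLike.congr_fun this f
  ext j : 1
  simp only [MonoidHom.comp_apply, Subgroup.subtype_apply, MonoidHom.prod_apply,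
    MonoidHom.id_apply]
  rcases eq_gen_or_eq_tailHom hrm j with ⟨k, hk⟩ | ⟨l, hl⟩
  · rw [hk, freeHom_gen, map_inv, pushoutHom_ofL, sectionHom_gen]
    refine Prod.ext rfl ?_
    change ((zpowersHom _ (gen hrm k)⁻¹) (coordHom n m k (genL i₀ hrm k : _)))⁻¹ = gen hrm k
    simp [coordHom, genL, theta_mulSingle, thetaComp_gen]
  · rw [hl, freeHom_tailHom, pushoutHom_ofTail]
    refine Prod.ext ?_ rfl
    change 1 = sectionHom i₀ m r _
    simp [sectionHom, invHom_tailHom]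

theorem pushoutHom_comp_toPushout (hrm : r ≤ m) :
    (pushoutHom hML hrm).comp (toPushout i₀ hML hrm) = MonoidHom.id _ := by
  refine MonoidHom.ext fun p => Subtype.ext ?_
  change ((pushoutHom hML hrm (PushoutI.base _ (kerPart i₀ p) * freeHom i₀ hML hrm p.1.2) :
    pairKer (n - 1) m r) : _ × _) = p.1
  rw [map_mul, Subgroup.coe_mul, pushoutHom_freeHom, pushoutHom, PushoutI.lift_base]
  refine Prod.ext ?_ (one_mul _)
  exact inv_mul_cancel_right p.1.1 (sectionHom i₀ m r p.1.2)

theorem toPushout_embTail (hrm : r ≤ m)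
    (p : (theta (n - 1) m r).ker × FreeGroup (Fin (m - r))) :
    toPushout i₀ hML hrm (embTail n hrm p) = ofTail hML p := by
  obtain ⟨x, w⟩ := p
  have h : kerPart i₀ (embTail n hrm (x, w)) = x :=
    Subtype.ext <| by
      change (x : Fin (n - 1) → FreeGroup (Fin m)) * (sectionHom i₀ m r (tailHom hrm w))⁻¹ = x
      simp [sectionHom, invHom_tailHom]
  change PushoutI.base _ (kerPart i₀ (embTail n hrm (x, w))) *
    freeHom i₀ hML hrm (tailHom hrm w) = _
  rw [h, freeHom_tailHom, ← ofTail_mk_one, ← map_mul, Prod.mk_mul_mk, mul_one, one_mul]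

theorem toPushout_embL (hrm : r ≤ m) (k : Fin r) (a : (thetaK (n - 1) m r k).ker) :
    toPushout i₀ hML hrm (embL n hrm k a) = ofL hML k a := by
  change PushoutI.base _ (kerPart i₀ (embL n hrm k a)) * freeHom i₀ hML hrm
    ((gen hrm k)⁻¹ ^ Multiplicative.toAdd (coordHom n m k (a : _))) = _
  rw [map_zpow, map_inv, freeHom_gen, inv_inv, ← ofL_inclusion hML k, ← map_zpow, ← map_mul]
  congr 1
  apply Subtype.ext
  simp [kerPart, embL, sectionHom_gen]

theorem toPushout_comp_pushoutHom (hrm : r ≤ m) :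
    (toPushout i₀ hML hrm).comp (pushoutHom hML hrm) = MonoidHom.id _ := by
  refine PushoutI.hom_ext_nonempty fun o => MonoidHom.ext fun x => ?_
  cases o with
  | none =>
    exact (congrArg _ (pushoutHom_ofTail hML hrm x)).trans (toPushout_embTail i₀ hML hrm x)
  | some k =>
    exact (congrArg _ (pushoutHom_ofL hML hrm k x)).trans (toPushout_embL i₀ hML hrm k x)

end Splitting

/-- **Splitting theorem.**  For `n ≥ 2` and `1 ≤ r ≤ m`, with `M = K^{n-1}_m(r)` and
`L_k = ker θ_k`, one has `M ≤ L_k`, each `L_k ≅ K^{n-1}_m(r-1)`, and `K^n_m(r)` is isomorphic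
to the amalgamated free product over `M` of `L_1, …, L_r` and `M × F_{m-r}`. -/
theorem Knmr_splitting (n m r : ℕ) (hn : 2 ≤ n) (hr : 1 ≤ r) (hrm : r ≤ m) :
    ∃ hML : ∀ k : Fin r, (theta (n - 1) m r).ker ≤ (thetaK (n - 1) m r k).ker,
      (∀ k : Fin r,
        Nonempty (↥((thetaK (n - 1) m r k).ker) ≃* ↥((theta (n - 1) m (r - 1)).ker))) ∧
      Nonempty (↥((theta n m r).ker) ≃* Monoid.PushoutI (phifam n m r hML)) := by
  refine ⟨ker_theta_le_ker_thetaK (n - 1) m r, fun k => ⟨kerThetaKEquiv (n - 1) hrm k⟩, ?_⟩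
  obtain ⟨N, rfl⟩ : ∃ N, n = N + 1 := ⟨n - 1, by omega⟩
  let i₀ : Fin (N + 1 - 1) := ⟨0, by omega⟩
  exact ⟨(kerThetaSuccEquiv N m r).trans
    (MonoidHom.toMulEquiv (toPushout i₀ _ hrm) (pushoutHom _ hrm)
      (pushoutHom_comp_toPushout i₀ _ hrm) (toPushout_comp_pushoutHom i₀ _ hrm))⟩
end

section
/- Let K^3_2(2) be the kernel of θ : F_2^{(1)} × F_2^{(2)} × F_2^{(3)} → ℤ², where F_2^{(i)} is free on x_i, y_i and θ(x_i) = t_1, θ(y_i) = t_2 for each i. Then the Dehn function of K^3_2(2) satisfies δ(l) ⪰ l³: for every finite presentation P of K^3_2(2), the function l ↦ l³ satisfies l³ ⪯ δ_P. -/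
open Subgroup

open scoped commutatorElement

/-- A normalized integral 2-cocycle on `G`, pulled back along a homomorphism from a free group,
is a coboundary. -/
theorem exists_coboundary {X G : Type*} [Group G] (π : FreeGroup X →* G) (c : G → G → ℤ)
    (hc : ∀ g h k, c g h + c (g * h) k = c h k + c g (h * k)) (hc₁ : ∀ g, c 1 g = 0)
    (hc₂ : ∀ g, c g 1 = 0) :
    ∃ S : FreeGroup X → ℤ, ∀ v w, S (v * w) = S v + S w + c (π v) (π w) := by
  let T : ℤ → G → Equiv.Perm (ℤ × G) := fun s a =>
    { toFun := fun p => (p.1 + s + c a p.2, a * p.2)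
      invFun := fun p => (p.1 - s - c a (a⁻¹ * p.2), a⁻¹ * p.2)
      left_inv := fun p => Prod.ext (by simp; ring) (by simp)
      right_inv := fun p => Prod.ext (by simp; ring) (by simp) }
  have hmul (s t : ℤ) (a b : G) : T s a * T t b = T (s + t + c a b) (a * b) := by
    ext ⟨r, g⟩
    · simp only [Equiv.Perm.mul_apply, T, Equiv.coe_fn_mk]
      linarith [hc a b g]
    · simp [T, mul_assoc]
  have hone : T 0 1 = 1 := by
    ext ⟨r, g⟩ <;> simp [T, hc₁]
  have hinv (s : ℤ) (a : G) : (T s a)⁻¹ = T (-s - c a⁻¹ a) a⁻¹ := by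
    rw [inv_eq_iff_mul_eq_one, mul_eq_one_iff_eq_inv, eq_comm, inv_eq_iff_mul_eq_one, hmul,
      inv_mul_cancel, ← hone]
    congr 1
    ring
  let f : FreeGroup X →* Equiv.Perm (ℤ × G) := FreeGroup.lift fun x => T 0 (π (FreeGroup.of x))
  have hf (w : FreeGroup X) : ∃ s, f w = T s (π w) := by
    induction w using FreeGroup.induction_on with
    | C1 => exact ⟨0, by simp [hone]⟩
    | of x => exact ⟨0, by simp [f]⟩
    | inv_of x ih =>
      obtain ⟨s, hs⟩ := ih
      exact ⟨_, by rw [map_inv, hs, hinv, map_inv]⟩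
    | mul v w hv hw =>
      obtain ⟨s, hs⟩ := hv
      obtain ⟨t, ht⟩ := hw
      exact ⟨_, by rw [map_mul, hs, ht, hmul, map_mul]⟩
  choose S hS using hf
  refine ⟨S, fun v w => ?_⟩
  have h : T (S (v * w)) (π (v * w)) = T (S v + S w + c (π v) (π w)) (π v * π w) := by
    rw [← hS, map_mul, hS, hS, hmul]
  have := congrArg (fun e : Equiv.Perm (ℤ × G) => (e (0, 1)).1) h
  simpa [T, hc₂] using this

section Norm

variable {X : Type*}

theorem fgNorm_mul_le (v w : FreeGroup X) : fgNorm (v * w) ≤ fgNorm v + fgNorm w := by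
  classical exact FreeGroup.norm_mul_le v w

theorem fgNorm_inv (w : FreeGroup X) : fgNorm w⁻¹ = fgNorm w := by
  classical exact FreeGroup.norm_inv_eq

theorem fgNorm_pow_le (w : FreeGroup X) (n : ℕ) : fgNorm (w ^ n) ≤ n * fgNorm w := by
  classical
  induction n with
  | zero => simp [fgNorm]
  | succ n ih =>
    rw [pow_succ, add_mul, one_mul]
    exact (fgNorm_mul_le _ _).trans (by gcongr)

theorem fgNorm_commutator_le (v w : FreeGroup X) : fgNorm ⁅v, w⁆ ≤ 2 * (fgNorm v + fgNorm w) := by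
  have h₁ := fgNorm_mul_le (v * w * v⁻¹) w⁻¹
  have h₂ := fgNorm_mul_le (v * w) v⁻¹
  have h₃ := fgNorm_mul_le v w
  rw [fgNorm_inv] at h₁ h₂
  rw [commutatorElement_def]
  omega

theorem finite_fgNorm_le [Finite X] (l : ℕ) : {w : FreeGroup X | fgNorm w ≤ l}.Finite := by
  classical
  exact (List.finite_length_le (X × Bool) l).preimage FreeGroup.toWord_injective.injOn

end Norm

section Area

variable {X : Type*} {R : Set (FreeGroup X)} {w : FreeGroup X}

theorem exists_exprOf (hw : w ∈ normalClosure R) : ∃ N, ExprOf R w N := by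
  rw [normalClosure, ← mem_toSubmonoid, closure_toSubmonoid] at hw
  obtain ⟨l, hl, rfl⟩ := Submonoid.exists_list_of_mem_closure hw
  clear hw
  have conj (g : FreeGroup X) (hg : g ∈ Group.conjugatesOfSet R) :
      ∃ a, ∃ r ∈ R, a * r * a⁻¹ = g := by
    obtain ⟨r, hr, h⟩ := Group.mem_conjugatesOfSet_iff.1 hg
    obtain ⟨a, ha⟩ := isConj_iff.1 h
    exact ⟨a, r, hr, ha⟩
  induction l with
  | nil => exact ⟨0, [], by simp⟩
  | cons g l ih =>
    obtain ⟨N, L, rfl, hL, hprod⟩ := ih fun x hx => hl x (List.mem_cons_of_mem _ hx)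
    obtain ⟨a, r, hr, hg⟩ : ∃ a r, (r ∈ R ∨ r⁻¹ ∈ R) ∧ a * r * a⁻¹ = g := by
      rcases hl g List.mem_cons_self with h | h
      · obtain ⟨a, r, hr, h⟩ := conj _ h
        exact ⟨a, r, .inl hr, h⟩
      · obtain ⟨a, r, hr, h⟩ := conj _ h
        refine ⟨a, r⁻¹, .inr (by simpa using hr), ?_⟩
        rw [← inv_inv g, ← h]
        group
    refine ⟨_, (a, r) :: L, rfl, ?_, by simp [hprod, hg]⟩
    simpa using ⟨hr, fun a b h => hL (a, b) h⟩

theorem exprOf_area (hw : w ∈ normalClosure R) : ExprOf R w (area R w) :=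
  Nat.sInf_mem (s := {N | ExprOf R w N}) (exists_exprOf hw)

theorem area_le_dehn [Finite X] (hw : w ∈ normalClosure R) {l : ℕ} (hl : fgNorm w ≤ l) :
    area R w ≤ dehn R l := by
  refine le_csSup (((finite_fgNorm_le (X := X) l).image (area R)).bddAbove.mono ?_)
    ⟨w, hw, hl, rfl⟩
  rintro _ ⟨v, -, hv, rfl⟩
  exact ⟨v, hv, rfl⟩

/-- A cochain whose coboundary is pulled back from the presented group bounds area from below,
up to a constant. -/
theorem exists_natAbs_le_mul_area {G : Type*} [Group G] {φ : FreeGroup X →* G} (hR : R.Finite)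
    (hφ : φ.ker = normalClosure R) {c : G → G → ℤ} (hc₁ : ∀ g, c 1 g = 0) (hc₂ : ∀ g, c g 1 = 0)
    {S : FreeGroup X → ℤ} (hS : ∀ v w, S (v * w) = S v + S w + c (φ v) (φ w)) :
    ∃ C : ℕ, ∀ w ∈ normalClosure R, (S w).natAbs ≤ C * area R w := by
  obtain ⟨C, hC⟩ := (hR.image fun r => (S r).natAbs).bddAbove
  have hS₁ : S 1 = 0 := by simpa [hc₁] using hS 1 1
  have hRφ {r : FreeGroup X} (hr : r ∈ R ∨ r⁻¹ ∈ R) : φ r = 1 := by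
    rw [← MonoidHom.mem_ker, hφ]
    rcases hr with h | h
    · exact subset_normalClosure h
    · simpa using inv_mem (subset_normalClosure h)
  have hSinv {r : FreeGroup X} (hr : φ r = 1) : S r⁻¹ = -S r := by
    have := hS r r⁻¹
    rw [mul_inv_cancel, hS₁, hr, hc₁] at this
    linarith
  have hSconj (a : FreeGroup X) {r : FreeGroup X} (hr : φ r = 1) : S (a * r * a⁻¹) = S r := by
    have h₁ := hS (a * r) a⁻¹
    have h₂ := hS a a⁻¹
    rw [hS a r, map_mul, hr, hc₂, mul_one] at h₁
    rw [mul_inv_cancel, hS₁] at h₂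
    linarith
  have hbound {r : FreeGroup X} (hr : r ∈ R ∨ r⁻¹ ∈ R) : (S r).natAbs ≤ C := by
    rcases hr with h | h
    · exact hC ⟨r, h, rfl⟩
    · have := hC ⟨r⁻¹, h, rfl⟩
      simpa [hSinv (hRφ (.inr h))] using this
  refine ⟨C, fun w hw => ?_⟩
  obtain ⟨L, hlen, hL, rfl⟩ := exprOf_area hw
  rw [← hlen]
  clear hlen hw
  induction L with
  | nil => simp [hS₁]
  | cons p L ih =>
    have hp := hL p List.mem_cons_self
    have h := ih fun q hq => hL q (List.mem_cons_of_mem _ hq)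
    have h₁ : φ (p.1 * p.2 * p.1⁻¹) = 1 := by simp [hRφ hp]
    rw [List.map_cons, List.prod_cons, hS, h₁, hc₁, hSconj _ (hRφ hp), List.length_cons, mul_add,
      mul_one]
    have := hbound hp
    omega

end Area

/-- The exponent sum of the `i`-th basis element. -/
def exponentSum (i : Fin 2) (w : FreeGroup (Fin 2)) : ℤ := (thetaComp 2 2 w).toAdd i

theorem exponentSum_one (i : Fin 2) : exponentSum i 1 = 0 := by simp [exponentSum]

theorem exponentSum_mul (i : Fin 2) (v w : FreeGroup (Fin 2)) :
    exponentSum i (v * w) = exponentSum i v + exponentSum i w := by simp [exponentSum]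

theorem exponentSum_inv (i : Fin 2) (v : FreeGroup (Fin 2)) :
    exponentSum i v⁻¹ = -exponentSum i v := by simp [exponentSum]

theorem exponentSum_pow (i : Fin 2) (v : FreeGroup (Fin 2)) (n : ℕ) :
    exponentSum i (v ^ n) = n * exponentSum i v := by simp [exponentSum]

theorem exponentSum_of (i j : Fin 2) :
    exponentSum i (FreeGroup.of j) = if i = j then 1 else 0 := by
  fin_cases i <;> fin_cases j <;> simp [exponentSum, thetaComp]

theorem mem_ker_theta_iff {k : Fin 3 → FreeGroup (Fin 2)} :
    k ∈ (theta 3 2 2).ker ↔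
      ∀ i, exponentSum i (k 0) + exponentSum i (k 1) + exponentSum i (k 2) = 0 := by
  have h : theta 3 2 2 k = thetaComp 2 2 (k 0) * thetaComp 2 2 (k 1) * thetaComp 2 2 (k 2) := by
    refine (Finset.noncommProd_eq_prod Finset.univ fun i => thetaComp 2 2 (k i)).trans ?_
    rw [Fin.prod_univ_three]
  rw [MonoidHom.mem_ker, h, ← toAdd_eq_zero, funext_iff]
  rfl

/-- The central coordinate of the Heisenberg group quotient of the free group of rank two. -/
theorem exists_heisenbergCoordinate : ∃ z : FreeGroup (Fin 2) → ℤ,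
    ∀ v w, z (v * w) = z v + z w + exponentSum 0 v * exponentSum 1 w :=
  exists_coboundary (MonoidHom.id _) (fun v w => exponentSum 0 v * exponentSum 1 w)
    (fun g h k => by simp only [exponentSum_mul]; ring) (fun g => by simp [exponentSum_one])
    (fun g => by simp [exponentSum_one])

/-- A 2-cocycle on `K³₂(2)` which detects the cubic area of the commutators
`⁅⁅xⁿ, yⁿ⁆, vⁿ⁆`. -/
theorem exists_cocycle : ∃ c : (theta 3 2 2).ker → (theta 3 2 2).ker → ℤ,
    (∀ g h k, c g h + c (g * h) k = c h k + c g (h * k)) ∧ (∀ g, c 1 g = 0) ∧ (∀ g, c g 1 = 0) ∧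
    ∃ p q a : (theta 3 2 2).ker, ∀ n : ℕ, Commute ⁅p ^ n, q ^ n⁆ (a ^ n) ∧
      c ⁅p ^ n, q ^ n⁆ (a ^ n) - c (a ^ n) ⁅p ^ n, q ^ n⁆ = 2 * (n : ℤ) ^ 3 := by
  obtain ⟨z, hz⟩ := exists_heisenbergCoordinate
  have hz₁ : z 1 = 0 := by simpa [exponentSum_one] using hz 1 1
  have hzcomm (v w : FreeGroup (Fin 2)) :
      z ⁅v, w⁆ = exponentSum 0 v * exponentSum 1 w - exponentSum 0 w * exponentSum 1 v := by
    have h := hz ⁅v, w⁆ (w * v)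
    have h' : ⁅v, w⁆ * (w * v) = v * w := by rw [commutatorElement_def]; group
    rw [h', hz, hz w v, commutatorElement_def] at h
    simp only [exponentSum_mul, exponentSum_inv] at h
    rw [commutatorElement_def]
    linarith
  let ψ : (Fin 3 → FreeGroup (Fin 2)) → ℤ := fun g =>
    z (g 0) - z (g 1) + exponentSum 0 (g 2) * exponentSum 1 (g 0)
  let c : (Fin 3 → FreeGroup (Fin 2)) → (Fin 3 → FreeGroup (Fin 2)) → ℤ := fun g h =>
    2 * ψ g * exponentSum 0 (h 2)
      + 2 * exponentSum 0 (g 1) * (exponentSum 0 (h 2) * exponentSum 1 (h 2) - z (h 2))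
      + exponentSum 1 (g 0) * exponentSum 0 (h 2) ^ 2
  let x : FreeGroup (Fin 2) := FreeGroup.of 0
  let y : FreeGroup (Fin 2) := FreeGroup.of 1
  refine ⟨fun g h => c g h, ?_, ?_, ?_, ⟨![x, x⁻¹, 1], ?_⟩, ⟨![y, 1, y⁻¹], ?_⟩,
    ⟨![1, x⁻¹, x], ?_⟩, fun n => ⟨?_, ?_⟩⟩
  · rintro ⟨g, hg⟩ ⟨h, hh⟩ ⟨k, hk⟩
    rw [mem_ker_theta_iff] at hg hh hk
    have hg₀ : exponentSum 0 (g 2) = -exponentSum 0 (g 0) - exponentSum 0 (g 1) := by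
      linarith [hg 0]
    have hh₀ : exponentSum 0 (h 2) = -exponentSum 0 (h 0) - exponentSum 0 (h 1) := by
      linarith [hh 0]
    have hh₁ : exponentSum 1 (h 2) = -exponentSum 1 (h 0) - exponentSum 1 (h 1) := by
      linarith [hh 1]
    simp only [c, ψ, Subgroup.coe_mul, Pi.mul_apply, hz, exponentSum_mul, hg₀, hh₀, hh₁]
    ring
  · simp [c, ψ, hz₁, exponentSum_one]
  · simp [c, ψ, hz₁, exponentSum_one]
  · rw [mem_ker_theta_iff]
    simp [exponentSum_one, exponentSum_inv]
  · rw [mem_ker_theta_iff]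
    simp [exponentSum_one, exponentSum_inv]
  · rw [mem_ker_theta_iff]
    simp [exponentSum_one, exponentSum_inv]
  · rw [commute_iff_eq]
    ext i : 2
    fin_cases i <;> simp [commutatorElement_def]
  · have hz' := hzcomm (x ^ n) (y ^ n)
    simp only [exponentSum_pow, x, y, exponentSum_of] at hz'
    simp only [c, ψ, commutatorElement_def, Subgroup.coe_mul, Subgroup.coe_inv, Subgroup.coe_pow,
      Pi.mul_apply, Pi.inv_apply, Pi.pow_apply] at hz' ⊢
    simp [hz₁, exponentSum_one, exponentSum_mul, exponentSum_inv, exponentSum_pow, hz', x, y,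
      exponentSum_of]
    ring

/-- The Dehn function `δ` of `K³₂(2)` satisfies `δ(l) ⪰ l³`: for every finite presentation
`P` of `K³₂(2)`, `(l ↦ l³) ⪯ δ_P`. -/
theorem K322_dehn_lower_bound :
    ∀ (X : Type) (R : Set (FreeGroup X)) (φ : FreeGroup X →* ((theta 3 2 2).ker)),
      Finite X → R.Finite → Presents R φ →
      Preceq (fun l => l ^ 3) (dehn R) := by
  intro X R φ _ hR ⟨hsurj, hker⟩
  obtain ⟨c, hc, hc₁, hc₂, p, q, a, hpqa⟩ := exists_cocycle
  obtain ⟨S, hS⟩ := exists_coboundary φ c hc hc₁ hc₂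
  obtain ⟨C, hC⟩ := exists_natAbs_le_mul_area hR hker hc₁ hc₂ hS
  obtain ⟨p, rfl⟩ := hsurj p
  obtain ⟨q, rfl⟩ := hsurj q
  obtain ⟨a, rfl⟩ := hsurj a
  set M := 4 * (fgNorm p + fgNorm q) + 2 * fgNorm a
  refine ⟨C + M, fun n => ?_⟩
  obtain ⟨hcomm, hval⟩ := hpqa n
  simp only [← map_pow, ← map_commutatorElement] at hcomm hval
  set u := ⁅p ^ n, q ^ n⁆
  set v := a ^ n
  have hφ : φ ⁅u, v⁆ = 1 := by
    rw [map_commutatorElement, commutatorElement_eq_one_iff_commute]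
    exact hcomm
  have hw : ⁅u, v⁆ ∈ normalClosure R := by rwa [← hker, MonoidHom.mem_ker]
  have hSw : S ⁅u, v⁆ = 2 * (n : ℤ) ^ 3 := by
    have h := hS ⁅u, v⁆ (v * u)
    have h' : ⁅u, v⁆ * (v * u) = u * v := by rw [commutatorElement_def]; group
    rw [h', hφ, hc₁, hS u v, hS v u] at h
    linarith
  have hnorm : fgNorm ⁅u, v⁆ ≤ (C + M) * n + (C + M) := by
    have h₁ := fgNorm_commutator_le u v
    have h₂ := fgNorm_commutator_le (p ^ n) (q ^ n)
    have h₃ := fgNorm_pow_le p n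
    have h₄ := fgNorm_pow_le q n
    have h₅ := fgNorm_pow_le a n
    have h₆ : fgNorm ⁅u, v⁆ ≤ M * n := by
      simp only [M]
      linarith
    nlinarith [Nat.zero_le (C * n)]
  have hcube : n ^ 3 ≤ C * area R ⁅u, v⁆ := by
    have h := hC _ hw
    have : (S ⁅u, v⁆).natAbs = 2 * n ^ 3 := by
      rw [hSw]
      exact_mod_cast Int.natAbs_natCast (2 * n ^ 3)
    omega
  have hdehn := area_le_dehn hw hnorm
  calc n ^ 3 ≤ C * area R ⁅u, v⁆ := hcube
    _ ≤ (C + M) * dehn R ((C + M) * n + (C + M)) := by gcongr; omega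
    _ ≤ _ := by rw [add_assoc]; exact Nat.le_add_right _ _
end
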